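/- For every finite place of 𝔽₂(t), i.e., for every nonzero prime 𝔭 of the Dedekind domain 𝔽₂[t], there exist x, y, z in the 𝔭-adic completion k_𝔭 of 𝔽₂(t) such that y² + y·z + z² = f(x)·g(x). -/

import Mathlib

open IsDedekindDomain

/-- `a = t⁴ + t³ + 1` in `k = 𝔽₂(t)`. -/
noncomputable def aRF : RatFunc (ZMod 2) := RatFunc.X ^ 4 + RatFunc.X ^ 3 + 1

/-- `b = t` in `k = 𝔽₂(t)`. -/
noncomputable def bRF : RatFunc (ZMod 2) := RatFunc.X

/-- `f(x) = a⁻⁴·b·x² + x + a·b⁻¹`, with coefficients viewed in any field extension `K` of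
`𝔽₂(t)` (in particular, in any completion). -/
noncomputable def fC (K : Type*) [Field K] [Algebra (RatFunc (ZMod 2)) K] (x : K) : K :=
  (algebraMap (RatFunc (ZMod 2)) K aRF)⁻¹ ^ 4 * algebraMap (RatFunc (ZMod 2)) K bRF * x ^ 2
    + x + algebraMap (RatFunc (ZMod 2)) K aRF * (algebraMap (RatFunc (ZMod 2)) K bRF)⁻¹

/-- `g(x) = a⁻⁸·b²·x² + a⁻⁴·b·x + a⁻³ + 1`, with coefficients viewed in any field extension `K`
of `𝔽₂(t)`. -/
noncomputable def gC (K : Type*) [Field K] [Algebra (RatFunc (ZMod 2)) K] (x : K) : K :=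
  (algebraMap (RatFunc (ZMod 2)) K aRF)⁻¹ ^ 8 * algebraMap (RatFunc (ZMod 2)) K bRF ^ 2 * x ^ 2
    + (algebraMap (RatFunc (ZMod 2)) K aRF)⁻¹ ^ 4 * algebraMap (RatFunc (ZMod 2)) K bRF * x
    + (algebraMap (RatFunc (ZMod 2)) K aRF)⁻¹ ^ 3 + 1

open Polynomial in
theorem aux_sqrt (v : HeightOneSpectrum (Polynomial (ZMod 2))) (p : Polynomial (ZMod 2)) :
    ∃ y : Polynomial (ZMod 2), p - y ^ 2 ∈ v.asIdeal := by
  obtain ⟨f, hf, hf0⟩ := Submodule.exists_mem_ne_zero_of_ne_bot v.ne_bot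
  have hm : f.Monic := by
    have h0 : f.leadingCoeff ≠ 0 := leadingCoeff_ne_zero.mpr hf0
    have : ∀ c : ZMod 2, c ≠ 0 → c = 1 := by decide
    exact this _ h0
  have h1 : Module.Finite (ZMod 2) (Polynomial (ZMod 2) ⧸ Ideal.span {f}) := hm.finite_quotient
  have h2 : Finite (Polynomial (ZMod 2) ⧸ Ideal.span {f}) := Module.finite_of_finite (ZMod 2)
  have hle : Ideal.span {f} ≤ v.asIdeal := (Ideal.span_singleton_le_iff_mem _).mpr hf
  have h3 : Finite (Polynomial (ZMod 2) ⧸ v.asIdeal) :=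
    Finite.of_surjective _ (Ideal.Quotient.factor_surjective hle)
  have hp : v.asIdeal.IsPrime := v.isPrime
  have h4 : CharP (Polynomial (ZMod 2) ⧸ v.asIdeal) 2 :=
    charP_of_injective_algebraMap (algebraMap (ZMod 2) _).injective 2
  obtain ⟨z, hz⟩ := surjective_frobenius (Polynomial (ZMod 2) ⧸ v.asIdeal) 2
    (Ideal.Quotient.mk _ p)
  obtain ⟨y, rfl⟩ := Ideal.Quotient.mk_surjective z
  refine ⟨y, ?_⟩
  rw [← Ideal.Quotient.eq, ← hz, frobenius_def, map_pow]

theorem aux_AS {L : Type*} [Field L] [Valued L (WithZero (Multiplicative ℤ))] [CompleteSpace L]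
    [CharP L 2] (e : L) (he : Valued.v e < 1) : ∃ z : L, z ^ 2 + z = e := by
  have ht : Filter.Tendsto (fun n : ℕ => e ^ n) Filter.atTop (nhds 0) :=
    Valued.tendsto_zero_pow_of_v_lt_one he
  have ht2 : Filter.Tendsto (fun n : ℕ => e ^ (2 ^ n)) Filter.atTop (nhds 0) :=
    ht.comp (tendsto_pow_atTop_atTop_of_one_lt one_lt_two)
  have hs : Summable (fun n : ℕ => e ^ (2 ^ n)) := by
    haveI : NonarchimedeanAddGroup L :=
      { is_nonarchimedean := by
          intro U hU
          obtain ⟨γ, hγ⟩ := Valued.mem_nhds_zero.mp hU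
          exact ⟨⟨Valued.v.restrict.ltAddSubgroup γ, Valued.isOpen_ball L γ.1⟩, hγ⟩ }
    apply NonarchimedeanAddGroup.summable_of_tendsto_cofinite_zero
    rwa [Nat.cofinite_eq_atTop]
  refine ⟨∑' n : ℕ, e ^ (2 ^ n), ?_⟩
  have h1 : (∑' n : ℕ, e ^ (2 ^ n)) ^ 2 = ∑' n : ℕ, e ^ (2 ^ (n + 1)) := by
    have hc : Continuous (frobenius L 2) := by
      have : (frobenius L 2 : L → L) = fun x => x ^ 2 := by ext; simp [frobenius_def]
      rw [this]; fun_prop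
    have := hs.map_tsum (frobenius L 2) hc
    simp only [frobenius_def] at this
    rw [this]
    congr 1; ext n
    rw [← pow_mul, ← pow_succ]
  rw [h1]
  conv_lhs => rw [hs.tsum_eq_zero_add]
  have : CharP L 2 := inferInstance
  rw [add_comm, add_assoc, CharTwo.add_self_eq_zero]
  simp

theorem aux_norm (v : HeightOneSpectrum (Polynomial (ZMod 2))) (p : Polynomial (ZMod 2))
    (hp : p ∉ v.asIdeal) : ∃ y z : v.adicCompletion (RatFunc (ZMod 2)),
      y ^ 2 + y * z + z ^ 2 =
        algebraMap (RatFunc (ZMod 2)) (v.adicCompletion (RatFunc (ZMod 2)))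
          (algebraMap (Polynomial (ZMod 2)) (RatFunc (ZMod 2)) p) := by
  obtain ⟨y, hy⟩ := aux_sqrt v p
  have hyv : y ∉ v.asIdeal := fun h => hp <| by
    have := v.asIdeal.add_mem hy (v.asIdeal.mul_mem_left y h)
    ring_nf at this
    exact this
  have hval : ∀ q : Polynomial (ZMod 2),
      Valued.v (algebraMap (RatFunc (ZMod 2)) (v.adicCompletion (RatFunc (ZMod 2)))
          (algebraMap (Polynomial (ZMod 2)) (RatFunc (ZMod 2)) q))
        = v.valuation (RatFunc (ZMod 2)) (algebraMap _ (RatFunc (ZMod 2)) q) := fun q =>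
    HeightOneSpectrum.adicCompletion.valued_coe _ _ _
  have hchar : CharP (v.adicCompletion (RatFunc (ZMod 2))) 2 :=
    charP_of_injective_algebraMap
      ((algebraMap (RatFunc (ZMod 2)) (v.adicCompletion (RatFunc (ZMod 2)))).comp
        (algebraMap (ZMod 2) (RatFunc (ZMod 2)))).injective 2
  set φ : Polynomial (ZMod 2) →+* v.adicCompletion (RatFunc (ZMod 2)) :=
    (algebraMap (RatFunc (ZMod 2)) (v.adicCompletion (RatFunc (ZMod 2)))).comp
      (algebraMap (Polynomial (ZMod 2)) (RatFunc (ZMod 2))) with hφ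
  have hY : Valued.v (φ y) = 1 :=
    (hval y).trans ((v.valuation_eq_one_iff_notMem).mpr hyv)
  have hD : Valued.v (φ (p - y ^ 2)) < 1 := by
    refine lt_of_eq_of_lt (hval _) ((v.valuation_lt_one_iff_mem _).mpr hy)
  have hY0 : φ y ≠ 0 := by
    intro h; rw [h] at hY; simp at hY
  obtain ⟨z, hz⟩ := aux_AS (φ (p - y ^ 2) / φ y ^ 2) (by simpa [hY] using hD)
  refine ⟨φ y, φ y * z, ?_⟩
  change _ = φ p
  rw [eq_div_iff (pow_ne_zero 2 hY0), map_sub, map_pow] at hz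
  linear_combination hz

/-- For every nonzero prime `𝔭` of `𝔽₂[t]`, the equation `y² + yz + z² = f(x)g(x)` has a
solution in the `𝔭`-adic completion of `𝔽₂(t)`. -/
theorem chatelet_solvable_at_finite_places
    (v : HeightOneSpectrum (Polynomial (ZMod 2))) :
    ∃ x y z : v.adicCompletion (RatFunc (ZMod 2)),
      y ^ 2 + y * z + z ^ 2 =
        fC (v.adicCompletion (RatFunc (ZMod 2))) x * gC (v.adicCompletion (RatFunc (ZMod 2))) x := by
  classical
  set A : Polynomial (ZMod 2) := Polynomial.X ^ 4 + Polynomial.X ^ 3 + 1 with hA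
  have hchar : CharP (v.adicCompletion (RatFunc (ZMod 2))) 2 :=
    charP_of_injective_algebraMap
      ((algebraMap (RatFunc (ZMod 2)) (v.adicCompletion (RatFunc (ZMod 2)))).comp
        (algebraMap (ZMod 2) (RatFunc (ZMod 2)))).injective 2
  set φ : Polynomial (ZMod 2) →+* v.adicCompletion (RatFunc (ZMod 2)) :=
    (algebraMap (RatFunc (ZMod 2)) (v.adicCompletion (RatFunc (ZMod 2)))).comp
      (algebraMap (Polynomial (ZMod 2)) (RatFunc (ZMod 2))) with hφ
  have hφi : Function.Injective φ :=
    (algebraMap (RatFunc (ZMod 2)) (v.adicCompletion (RatFunc (ZMod 2)))).injective.comp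
      (IsFractionRing.injective (Polynomial (ZMod 2)) (RatFunc (ZMod 2)))
  have ha : algebraMap (RatFunc (ZMod 2)) (v.adicCompletion (RatFunc (ZMod 2))) aRF = φ A := by
    simp [hφ, hA, aRF]
  have hb : algebraMap (RatFunc (ZMod 2)) (v.adicCompletion (RatFunc (ZMod 2))) bRF
      = φ Polynomial.X := by
    simp [hφ, bRF]
  have hA0 : A ≠ 0 := by
    intro h
    have := congrArg (Polynomial.eval 0) h
    simp [hA] at this
  have h2 : (2 : v.adicCompletion (RatFunc (ZMod 2))) = 0 := CharTwo.two_eq_zero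
  have ha0 : φ A ≠ 0 := (map_ne_zero_iff φ hφi).mpr hA0
  have hb0 : φ Polynomial.X ≠ 0 := (map_ne_zero_iff φ hφi).mpr Polynomial.X_ne_zero
  have key : ∀ (p : Polynomial (ZMod 2)), p ∉ v.asIdeal →
      ∀ x r : v.adicCompletion (RatFunc (ZMod 2)),
      fC (v.adicCompletion (RatFunc (ZMod 2))) x * gC (v.adicCompletion (RatFunc (ZMod 2))) x
        = r ^ 2 * φ p → ∃ x y z : v.adicCompletion (RatFunc (ZMod 2)),
      y ^ 2 + y * z + z ^ 2 =
        fC (v.adicCompletion (RatFunc (ZMod 2))) x *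
          gC (v.adicCompletion (RatFunc (ZMod 2))) x := by
    intro p hp x r h
    obtain ⟨y, z, hyz⟩ := aux_norm v p hp
    refine ⟨x, r * y, r * z, ?_⟩
    rw [h]
    change _ = φ p at hyz
    rw [← hyz]; ring
  by_cases hX : Polynomial.X ∈ v.asIdeal
  · have hAX : φ A = φ Polynomial.X ^ 4 + φ Polynomial.X ^ 3 + 1 := by simp [hA]
    refine key ((Polynomial.X + 1) * (1 + A + A ^ 2)) ?_ 0 (φ Polynomial.X / φ A) ?_
    · intro h
      refine v.isPrime.ne_top ((Ideal.eq_top_iff_one _).mpr ?_)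
      have hA1 : A - 1 ∈ v.asIdeal := by
        have : A - 1 = (Polynomial.X ^ 3 + Polynomial.X ^ 2) * Polynomial.X := by rw [hA]; ring
        rw [this]; exact v.asIdeal.mul_mem_left _ hX
      have h3 : (3 : Polynomial (ZMod 2)) = 1 := by
        have : (2 : Polynomial (ZMod 2)) = 0 := CharTwo.two_eq_zero
        linear_combination this
      have e : (1 : Polynomial (ZMod 2)) = (Polynomial.X + 1) * (1 + A + A ^ 2)
          - (1 + A + A ^ 2) * Polynomial.X - (A + 2) * (A - 1) := by
        linear_combination -h3
      rw [e]
      exact v.asIdeal.sub_mem (v.asIdeal.sub_mem h (v.asIdeal.mul_mem_left _ hX))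
        (v.asIdeal.mul_mem_left _ hA1)
    · simp only [fC, gC, ha, hb, map_mul, map_add, map_pow, map_one]
      generalize φ A = a at *
      generalize φ Polynomial.X = b at *
      have h1 : a ^ 3 + 1 = b ^ 3 * (b + 1) * (1 + a + a ^ 2) := by
        linear_combination (1 + a + a ^ 2) * hAX + h2
      field_simp
      linear_combination a ^ 10 * h1
  · obtain ⟨q, hq, hq0⟩ := Submodule.exists_mem_ne_zero_of_ne_bot v.ne_bot
    have hq' : φ q ≠ 0 := (map_ne_zero_iff φ hφi).mpr hq0
    refine key (Polynomial.X * ((1 + q * A ^ 2 + q ^ 2 * A) *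
        (1 + q * A ^ 2 + q ^ 2 * A + q ^ 2 * A ^ 4))) ?_
      (φ A ^ 2 / (φ Polynomial.X * φ q)) (1 / (φ Polynomial.X * φ q ^ 2 * φ A ^ 2)) ?_
    · have hp := v.isPrime
      have aux : ∀ r : Polynomial (ZMod 2), 1 + r * q ∉ v.asIdeal := by
        intro r h
        refine v.isPrime.ne_top ((Ideal.eq_top_iff_one _).mpr ?_)
        simpa using v.asIdeal.sub_mem h (v.asIdeal.mul_mem_left r hq)
      intro h
      rcases hp.mem_or_mem h with h | h
      · exact hX h
      rcases hp.mem_or_mem h with h | h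
      · refine aux (A ^ 2 + q * A) ?_
        convert h using 1; ring
      · refine aux (A ^ 2 + q * A + q * A ^ 4) ?_
        convert h using 1; ring
    · simp only [fC, gC, ha, hb, map_mul, map_add, map_pow, map_one]
      generalize φ A = a at *
      generalize φ Polynomial.X = b at *
      generalize φ q = c at *
      field_simp
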